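/- There is no continuous map g : S^{2l-2} → ‖K‖ to the geometric realization of a finite simplicial complex K of dimension at most l-1 such that g(x) ≠ g(-x) for all x, for any l ≥ 2. -/

import Mathlib

namespace AntipodalFree

section Cochains

variable {X Y Λ : Type*}

/-- The (augmented) mod 2 simplicial coboundary on functions of ordered tuples. -/
def cob : (List X → ZMod 2) → List X → ZMod 2
  | _, [] => 0
  | φ, v :: w => φ w + cob (fun t => φ (v :: t)) w

/-- The prism operator of a pair of vertex maps. -/
def prism (f g : X → Y) : (List Y → ZMod 2) → List X → ZMod 2
  | _, [] => 0
  | φ, v :: w => φ (f v :: (v :: w).map g) + prism f g (fun t => φ (f v :: t)) w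

/-- The Alexander–Whitney diagonal: the sum of `c s t` over all ways of cutting a tuple at one
of its entries into a front face `s` and a back face `t`. -/
def diag : (List X → List X → ZMod 2) → List X → ZMod 2
  | _, [] => 0
  | c, v :: w => c [v] (v :: w) + diag (fun s t => c (v :: s) t) w

theorem cob_add (φ ψ : List X → ZMod 2) (l : List X) :
    cob (fun t => φ t + ψ t) l = cob φ l + cob ψ l := by
  induction l generalizing φ ψ with
  | nil => simp [cob]
  | cons v w ih => simp only [cob, ih]; ring

theorem prism_add (f g : X → Y) (φ ψ : List Y → ZMod 2) (l : List X) :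
    prism f g (fun t => φ t + ψ t) l = prism f g φ l + prism f g ψ l := by
  induction l generalizing φ ψ with
  | nil => simp [prism]
  | cons v w ih => simp only [prism, ih]; ring

theorem diag_add (c d : List X → List X → ZMod 2) (l : List X) :
    diag (fun s t => c s t + d s t) l = diag c l + diag d l := by
  induction l generalizing c d with
  | nil => simp [diag]
  | cons v w ih => simp only [diag, ih]; ring

/-- The prism operator is a cochain homotopy. -/
theorem prism_homotopy (f g : X → Y) (φ : List Y → ZMod 2) (l : List X) :
    prism f g (cob φ) l + cob (prism f g φ) l = φ (l.map f) + φ (l.map g) := by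
  induction l generalizing φ with
  | nil => simp [prism, cob, CharTwo.add_self_eq_zero]
  | cons v w ih =>
    have h := ih (fun t => φ (f v :: t))
    simp only [prism, cob, prism_add, cob_add, List.map_cons] at h ⊢
    have e : cob (fun t => φ (f v :: g v :: List.map g t)) w
        = cob (fun t => φ (f v :: g v :: t)) (List.map g w) := by
      generalize hψ : (fun t => φ (f v :: g v :: t)) = ψ
      have : (fun t => φ (f v :: g v :: List.map g t)) = fun t => ψ (t.map g) := by
        subst hψ; rfl
      rw [this]
      clear this hψ h ih
      induction w generalizing ψ with
      | nil => rfl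
      | cons a w ih => simp only [cob, List.map_cons]; rw [← ih]
    rw [e]
    grind

/-- The diagonal is a cochain map, up to the augmentation terms. -/
theorem diag_cob (c : List X → List X → ZMod 2) (l : List X) :
    diag (fun s t => cob (fun s' => c s' t) s + cob (c s) t) l + cob (diag c) l
      = c [] l + c l [] := by
  induction l generalizing c with
  | nil => simp [diag, cob, CharTwo.add_self_eq_zero]
  | cons v w ih =>
    have h := ih (fun s t => c (v :: s) t)
    simp only [diag, cob, cob_add, diag_add] at h ⊢
    grind

theorem cob_append (φ : List X → ZMod 2) (l : List X) (v : X) :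
    cob φ (l ++ [v]) = φ l + cob (fun t => φ (t ++ [v])) l := by
  induction l generalizing φ with
  | nil => simp [cob]
  | cons a w ih => simp only [List.cons_append, cob, ih]; ring

theorem diag_append (c : List X → List X → ZMod 2) (l : List X) (v : X) :
    diag c (l ++ [v]) = c (l ++ [v]) [v] + diag (fun s t => c s (t ++ [v])) l := by
  induction l generalizing c with
  | nil => simp [diag]
  | cons a w ih => simp only [List.cons_append, diag, ih]; ring

theorem cob_map (f : X → Y) (φ : List Y → ZMod 2) (l : List X) :
    cob φ (l.map f) = cob (fun t => φ (t.map f)) l := by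
  induction l generalizing φ with
  | nil => rfl
  | cons a w ih => simp only [cob, List.map_cons, ih]

theorem cob_reverse (φ : List X → ZMod 2) (l : List X) :
    cob φ l.reverse = cob (fun t => φ t.reverse) l := by
  induction l generalizing φ with
  | nil => rfl
  | cons a w ih => simp only [List.reverse_cons, cob_append, ih, cob]

theorem diag_map (f : X → Y) (c : List Y → List Y → ZMod 2) (l : List X) :
    diag c (l.map f) = diag (fun s t => c (s.map f) (t.map f)) l := by
  induction l generalizing c with
  | nil => rfl
  | cons a w ih => simp only [diag, List.map_cons, ih, List.map_nil]

theorem diag_reverse (c : List X → List X → ZMod 2) (l : List X) :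
    diag c l.reverse = diag (fun s t => c t.reverse s.reverse) l := by
  induction l generalizing c with
  | nil => rfl
  | cons a w ih => simp [List.reverse_cons, diag_append, ih, diag]

theorem prism_eq_zero (f g : X → Y) (φ : List Y → ZMod 2) (l : List X)
    (h : ∀ u : List Y, u.length = l.length + 1 →
      (∀ y ∈ u, ∃ x ∈ l, y = f x ∨ y = g x) → φ u = 0) :
    prism f g φ l = 0 := by
  induction l generalizing φ with
  | nil => rfl
  | cons v w ih =>
    rw [prism, h _ (by simp), ih, add_zero]
    · intro u hu hm
      refine h _ (by simp [hu]) ?_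
      intro y hy
      rcases List.mem_cons.1 hy with rfl | hy
      · exact ⟨v, by simp, Or.inl rfl⟩
      · obtain ⟨x, hx, hxy⟩ := hm y hy
        exact ⟨x, by simp [hx], hxy⟩
    · intro y hy
      rcases List.mem_cons.1 hy with rfl | hy
      · exact ⟨v, by simp, Or.inl rfl⟩
      · obtain ⟨x, hx, rfl⟩ := List.mem_map.1 hy
        exact ⟨x, hx, Or.inr rfl⟩

theorem diag_congr (c d : List X → List X → ZMod 2) (l : List X)
    (h : ∀ s t : List X, s.length + t.length = l.length + 1 → s ⊆ l → t ⊆ l → c s t = d s t) :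
    diag c l = diag d l := by
  induction l generalizing c d with
  | nil => rfl
  | cons v w ih =>
    rw [diag, diag, h _ _ (by simp; omega) (by simp) (by simp)]
    congr 1
    refine ih _ _ fun s t hl hs ht => h _ _ (by simp; omega) ?_ ?_
    · exact List.cons_subset_cons v hs
    · exact List.subset_cons_of_subset v ht

theorem diag_zero (l : List X) : diag (fun _ _ => 0) l = 0 := by
  induction l with
  | nil => rfl
  | cons v w ih => rw [diag, ih, add_zero]

end Cochains

section Normalized

variable {X Λ : Type*} [DecidableEq Λ]

/-- The coboundary on functions of finite sets. -/
def scob (F : Finset Λ → ZMod 2) (S : Finset Λ) : ZMod 2 := ∑ a ∈ S, F (S.erase a)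

/-- The alternating (normalized) cochain on tuples determined by a function of finite sets. -/
def alt (F : Finset Λ → ZMod 2) (l : List Λ) : ZMod 2 :=
  if l.Nodup then F l.toFinset else 0

/-- Contraction of a function of finite sets with a vertex. -/
def contract (v : Λ) (F : Finset Λ → ZMod 2) (S : Finset Λ) : ZMod 2 :=
  if v ∈ S then 0 else F (insert v S)

theorem alt_cons (F : Finset Λ → ZMod 2) (v : Λ) (l : List Λ) :
    alt F (v :: l) = alt (contract v F) l := by
  by_cases h : v ∈ l <;> simp [alt, contract, h]

theorem alt_add (F G : Finset Λ → ZMod 2) (l : List Λ) :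
    alt (fun S => F S + G S) l = alt F l + alt G l := by
  unfold alt; split_ifs <;> simp

theorem scob_contract (v : Λ) (F : Finset Λ → ZMod 2) (S : Finset Λ) :
    contract v (scob F) S + scob (contract v F) S = F S := by
  by_cases h : v ∈ S
  · rw [contract, if_pos h, zero_add, scob, Finset.sum_eq_single_of_mem v h]
    · simp [contract, h]
    · intro b _ hb
      simp [contract, h, hb.symm]
  · rw [contract, if_neg h, scob, Finset.sum_insert h, Finset.erase_insert h, scob, add_assoc]
    convert add_zero _
    rw [← Finset.sum_add_distrib]
    refine Finset.sum_eq_zero fun a ha => ?_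
    have hav : v ≠ a := fun e => h (e ▸ ha)
    rw [contract, if_neg (by simp [h]), Finset.erase_insert_of_ne hav]
    exact CharTwo.add_self_eq_zero _

theorem cob_alt (F : Finset Λ → ZMod 2) (l : List Λ) : cob (alt F) l = alt (scob F) l := by
  induction l generalizing F with
  | nil => simp [cob, alt, scob]
  | cons v w ih =>
    simp only [cob, alt_cons, ih]
    rw [← alt_add]
    congr 1
    funext S
    have := scob_contract v F S
    grind

/-- The cochain on pairs of tuples determined by a function of pairs of finite sets. -/
def alt₂ (C : Finset Λ → Finset Λ → ZMod 2) (s t : List Λ) : ZMod 2 :=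
  alt (fun S => alt (C S) t) s

theorem alt₂_swap (C : Finset Λ → Finset Λ → ZMod 2) (s t : List Λ) :
    alt₂ (fun S T => C T S) s t = alt₂ C t s := by
  unfold alt₂ alt; split_ifs <;> rfl

theorem alt₂_eq_ite (C : Finset Λ → Finset Λ → ZMod 2) (s t : List Λ) :
    alt₂ C s t = if s.Nodup ∧ t.Nodup then C s.toFinset t.toFinset else 0 := by
  unfold alt₂ alt
  split_ifs <;> first | rfl | tauto

theorem cob_alt₂_left (C : Finset Λ → Finset Λ → ZMod 2) (s t : List Λ) :
    cob (fun s' => alt₂ C s' t) s = alt₂ (fun S T => scob (fun S' => C S' T) S) s t := by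
  unfold alt₂
  rw [cob_alt]
  congr 1
  funext S
  unfold scob alt
  split_ifs <;> simp

theorem cob_alt₂_right (C : Finset Λ → Finset Λ → ZMod 2) (s t : List Λ) :
    cob (alt₂ C s) t = alt₂ (fun S T => scob (C S) T) s t := by
  have : alt₂ C s = fun t => alt₂ (fun S T => C T S) t s := by
    funext t; rw [alt₂_swap]
  rw [this, cob_alt₂_left, ← alt₂_swap]

end Normalized

section Antipode

variable {V : Type*} [InvolutiveNeg V]

/-- The antipode of a tuple, with the order of the entries reversed. -/
def antip (l : List V) : List V := (l.map Neg.neg).reverse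

theorem antip_antip (l : List V) : antip (antip l) = l := by
  simp [antip, List.map_reverse]

theorem mem_antip {l : List V} {x : V} : x ∈ antip l ↔ -x ∈ l := by
  simp only [antip, List.mem_reverse, List.mem_map]
  exact ⟨by rintro ⟨a, ha, rfl⟩; simpa using ha, fun h => ⟨-x, h, neg_neg x⟩⟩

theorem cob_antip (φ : List V → ZMod 2) (l : List V) :
    cob φ (antip l) = cob (fun t => φ (antip t)) l := by
  rw [antip, cob_reverse, cob_map]; rfl

end Antipode

section Small

variable {V : Type*} [NormedAddCommGroup V]

/-- A tuple of `j + 1` points of `A` with pairwise distances at most `d`. -/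
structure IsSmall (A : Set V) (j : ℕ) (d : ℝ) (l : List V) : Prop where
  length : l.length = j + 1
  mem : ∀ x ∈ l, x ∈ A
  dist_le : ∀ x ∈ l, ∀ y ∈ l, dist x y ≤ d

theorem IsSmall.antip {A : Set V} {j : ℕ} {d : ℝ} {l : List V} (h : IsSmall A j d l)
    (hA : ∀ x ∈ A, -x ∈ A) : IsSmall A j d (antip l) := by
  refine ⟨by simp [AntipodalFree.antip, h.length], ?_, ?_⟩
  · intro x hx
    simpa using hA _ (h.mem (-x) (mem_antip.1 hx))
  · intro x hx y hy
    rw [← dist_neg_neg]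
    exact h.dist_le _ (mem_antip.1 hx) _ (mem_antip.1 hy)

theorem IsSmall.mono {A B : Set V} {j : ℕ} {d d' : ℝ} {l : List V} (h : IsSmall A j d l)
    (hAB : A ⊆ B) (hd : d ≤ d') : IsSmall B j d' l :=
  ⟨h.length, fun x hx => hAB (h.mem x hx), fun x hx y hy => (h.dist_le x hx y hy).trans hd⟩

end Small

section Hemispheres

variable {V : Type*} [NormedAddCommGroup V] [NormedSpace ℝ V]

/-- Contraction of the space towards `p` at time `i / m`. -/
noncomputable def pull (m : ℕ) (p : V) (i : ℕ) (x : V) : V :=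
  (1 - (i / m : ℝ)) • x + (i / m : ℝ) • p

/-- Evaluation of cochains on the fundamental chain of the `j`-dimensional hemisphere of the
cross-polytope with vertices `± e i`: the hemisphere of dimension `j + 1` is the cone, cut into `m`
layers, from `e (j + 1)` over the sphere of dimension `j`. -/
noncomputable def hem (e : ℕ → V) (m : ℕ) : ℕ → (List V → ZMod 2) → ZMod 2
  | 0, φ => φ [e 0]
  | j + 1, φ => ∑ i ∈ Finset.range m,
      (hem e m j (prism (pull m (e (j + 1)) i) (pull m (e (j + 1)) (i + 1)) φ) +
        hem e m j (fun l => prism (pull m (e (j + 1)) i) (pull m (e (j + 1)) (i + 1)) φ (antip l)))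

/-- Evaluation of cochains on the fundamental cycle of the `j`-dimensional sphere. -/
noncomputable def sph (e : ℕ → V) (m j : ℕ) (φ : List V → ZMod 2) : ZMod 2 :=
  hem e m j φ + hem e m j (fun l => φ (antip l))

variable (e : ℕ → V) (m : ℕ)

theorem hem_succ (j : ℕ) (φ : List V → ZMod 2) :
    hem e m (j + 1) φ = ∑ i ∈ Finset.range m,
      sph e m j (prism (pull m (e (j + 1)) i) (pull m (e (j + 1)) (i + 1)) φ) := rfl

theorem hem_add (j : ℕ) (φ ψ : List V → ZMod 2) :
    hem e m j (fun l => φ l + ψ l) = hem e m j φ + hem e m j ψ := by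
  induction j generalizing φ ψ with
  | zero => rfl
  | succ j ih =>
    simp only [hem]
    rw [← Finset.sum_add_distrib]
    refine Finset.sum_congr rfl fun i _ => ?_
    simp only [funext (prism_add _ _ φ ψ), ih]
    ring

theorem sph_add (j : ℕ) (φ ψ : List V → ZMod 2) :
    sph e m j (fun l => φ l + ψ l) = sph e m j φ + sph e m j ψ := by
  simp only [sph, hem_add]; ring

theorem sph_antip (j : ℕ) (φ : List V → ZMod 2) :
    sph e m j (fun l => φ (antip l)) = sph e m j φ := by
  simp only [sph, antip_antip]; ring

theorem sph_length (j : ℕ) (φ : ℕ → ZMod 2) : sph e m j (fun l => φ l.length) = 0 := by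
  simp [sph, antip, CharTwo.add_self_eq_zero]

theorem hem_succ_cob_of_cycle (hm : 0 < m) (j : ℕ)
    (hc : ∀ ψ, sph e m j (cob ψ) = 0) (φ : List V → ZMod 2) :
    hem e m (j + 1) (cob φ) = sph e m j φ := by
  set p := e (j + 1)
  have key : ∀ i, sph e m j (prism (pull m p i) (pull m p (i + 1)) (cob φ)) =
      sph e m j (fun l => φ (l.map (pull m p (i + 1)))) -
        sph e m j (fun l => φ (l.map (pull m p i))) := by
    intro i
    have h := hc (prism (pull m p i) (pull m p (i + 1)) φ)
    have h2 := sph_add e m j (prism (pull m p i) (pull m p (i + 1)) (cob φ))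
      (cob (prism (pull m p i) (pull m p (i + 1)) φ))
    simp only [prism_homotopy, sph_add] at h2
    rw [h, add_zero] at h2
    rw [← h2, CharTwo.sub_eq_add, add_comm]
  rw [hem_succ, Finset.sum_congr rfl fun i _ => key i,
    Finset.sum_range_sub fun i => sph e m j fun l => φ (l.map (pull m p i))]
  have h0 : ∀ l : List V, l.map (pull m p 0) = l := fun l => by
    rw [show pull m p 0 = id by funext x; simp [pull], List.map_id]
  have h1 : ∀ l : List V, l.map (pull m p m) = List.replicate l.length p := fun l => by
    have : (m : ℝ) ≠ 0 := by positivity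
    rw [show pull m p m = fun _ => p by funext x; simp [pull, this], List.map_const']
  simp only [h0, h1]
  rw [sph_length e m j (fun n => φ (List.replicate n p)), CharTwo.sub_eq_add, zero_add]

theorem sph_cob (hm : 0 < m) (j : ℕ) (φ : List V → ZMod 2) : sph e m j (cob φ) = 0 := by
  induction j generalizing φ with
  | zero => simp [sph, hem, cob, antip, CharTwo.add_self_eq_zero]
  | succ j ih =>
    rw [sph]
    simp only [cob_antip]
    rw [hem_succ_cob_of_cycle e m hm j ih, show (fun l => cob (fun t => φ (antip t)) l) =
      cob (fun t => φ (antip t)) from rfl, hem_succ_cob_of_cycle e m hm j ih, sph_antip]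
    exact CharTwo.add_self_eq_zero _

theorem hem_succ_cob (hm : 0 < m) (j : ℕ) (φ : List V → ZMod 2) :
    hem e m (j + 1) (cob φ) = sph e m j φ :=
  hem_succ_cob_of_cycle e m hm j (sph_cob e m hm j) φ

/-- The data `A j` of spheres spanned by `e 0, …, e j` which are successively contained in cones:
`A (j + 1)` contains the cone over `A j` with apex `e (j + 1)`, for `j < n`. -/
structure IsConeTower (e : ℕ → V) (n : ℕ) (A : ℕ → Set V) : Prop where
  neg_mem : ∀ j, ∀ x ∈ A j, -x ∈ A j
  norm_le : ∀ j, ∀ x ∈ A j, ‖x‖ ≤ 1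
  vertex_mem : ∀ j ≤ n, e j ∈ A j
  cone_mem : ∀ j < n, ∀ x ∈ A j, ∀ t : ℝ, 0 ≤ t → t ≤ 1 →
    (1 - t) • x + t • e (j + 1) ∈ A (j + 1)
  mono : Monotone A

theorem hem_zero (j : ℕ) : hem e m j (fun _ => 0) = 0 := by
  have h := hem_add e m j (fun _ => 0) (fun _ => 0)
  simp only [add_zero] at h
  rwa [CharTwo.add_self_eq_zero] at h

theorem dist_pull_le (hm : 0 < m) {i i' : ℕ} (him : i ≤ m) (hi : i' = i ∨ i' = i + 1 ∨ i = i' + 1)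
    {p x y : V} (hp : ‖p‖ ≤ 1) (hy : ‖y‖ ≤ 1) :
    dist (pull m p i x) (pull m p i' y) ≤ dist x y + 2 / m := by
  have hm' : (0 : ℝ) < m := by exact_mod_cast hm
  have e1 : pull m p i x - pull m p i' y
      = (1 - (i / m : ℝ)) • (x - y) + (((i : ℝ) - i') / m) • (p - y) := by
    simp only [pull, sub_div, smul_sub, sub_smul, one_smul]
    abel
  have hi0 : (0 : ℝ) ≤ i / m := by positivity
  have hi1 : (i / m : ℝ) ≤ 1 := by
    rw [div_le_one hm']; exact_mod_cast him
  have hii : |(i : ℝ) - i'| ≤ 1 := by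
    rcases hi with rfl | rfl | rfl <;> simp
  rw [dist_eq_norm, dist_eq_norm, e1]
  refine (norm_add_le _ _).trans (add_le_add ?_ ?_)
  · rw [norm_smul, Real.norm_eq_abs, abs_of_nonneg (by linarith)]
    exact mul_le_of_le_one_left (norm_nonneg _) (by linarith)
  · rw [norm_smul, Real.norm_eq_abs, abs_div, abs_of_pos hm', div_mul_eq_mul_div]
    gcongr
    calc |(i : ℝ) - i'| * ‖p - y‖ ≤ 1 * (1 + 1) :=
          mul_le_mul hii ((norm_sub_le _ _).trans (add_le_add hp hy)) (norm_nonneg _) zero_le_one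
      _ = 2 := by norm_num

/-- The fundamental chains of the hemispheres are carried by small tuples. -/
theorem hem_eq_zero {n : ℕ} {A : ℕ → Set V} (hm : 0 < m)
    (hA : IsConeTower e n A) {j : ℕ} (hj : j ≤ n) (φ : List V → ZMod 2)
    (h : ∀ l, IsSmall (A j) j (2 * j / m) l → φ l = 0) : hem e m j φ = 0 := by
  induction j generalizing φ with
  | zero => exact h _ ⟨by simp, by simpa using hA.vertex_mem 0 hj, by simp⟩
  | succ j ih =>
    have hm' : (0 : ℝ) < m := by exact_mod_cast hm
    have key : ∀ i < m, ∀ l, IsSmall (A j) j (2 * j / m) l →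
        prism (pull m (e (j + 1)) i) (pull m (e (j + 1)) (i + 1)) φ l = 0 := by
      intro i hi l hl
      refine prism_eq_zero _ _ _ _ fun u hu hul => h u ⟨by rw [hu, hl.length], ?_, ?_⟩
      · have : ∀ i' ≤ m, ∀ x ∈ l, pull m (e (j + 1)) i' x ∈ A (j + 1) := by
          intro i' hi' x hx
          refine hA.cone_mem j hj x (hl.mem x hx) _ (by positivity) ?_
          rw [div_le_one hm']; exact_mod_cast hi'
        intro y hy
        obtain ⟨x, hx, rfl | rfl⟩ := hul y hy
        · exact this _ hi.le x hx
        · exact this _ hi x hx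
      · have hp := hA.norm_le _ _ (hA.vertex_mem (j + 1) hj)
        have hd : ∀ x ∈ l, ∀ y ∈ l, dist x y + 2 / m ≤ 2 * ((j + 1 : ℕ) : ℝ) / m := by
          intro x hx y hy
          have := hl.dist_le x hx y hy
          push_cast
          calc dist x y + 2 / m ≤ 2 * j / m + 2 / m := by gcongr
            _ = _ := by ring
        intro a ha b hb
        obtain ⟨x, hx, rfl | rfl⟩ := hul a ha <;> obtain ⟨y, hy, rfl | rfl⟩ := hul b hb <;>
          exact (dist_pull_le m hm (by omega) (by omega) hp
            (hA.norm_le j y (hl.mem y hy))).trans (hd x hx y hy)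
    rw [hem_succ]
    refine Finset.sum_eq_zero fun i hi => ?_
    have hi := Finset.mem_range.1 hi
    rw [sph, ih (by omega) _ (key i hi),
      ih (by omega) _ fun l hl => key i hi _ (hl.antip (hA.neg_mem j)),
      add_zero]

theorem hem_congr {n : ℕ} {A : ℕ → Set V} (hm : 0 < m)
    (hA : IsConeTower e n A) {j : ℕ} (hj : j ≤ n) (φ ψ : List V → ZMod 2)
    (h : ∀ l, IsSmall (A j) j (2 * j / m) l → φ l = ψ l) : hem e m j φ = hem e m j ψ := by
  have := hem_eq_zero e m hm hA hj (fun l => φ l + ψ l)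
    fun l hl => by rw [h l hl]; exact CharTwo.add_self_eq_zero _
  rw [hem_add] at this
  exact CharTwo.add_eq_zero.1 this

theorem sph_congr {n : ℕ} {A : ℕ → Set V} (hm : 0 < m) (hA : IsConeTower e n A) {j : ℕ}
    (hj : j ≤ n) (φ ψ : List V → ZMod 2)
    (h : ∀ l, IsSmall (A j) j (2 * j / m) l → φ l = ψ l) : sph e m j φ = sph e m j ψ := by
  rw [sph, sph, hem_congr e m hm hA hj φ ψ h,
    hem_congr e m hm hA hj _ _ fun l hl => h _ (hl.antip (hA.neg_mem j))]

theorem sph_zero (j : ℕ) : sph e m j (fun _ => 0) = 0 := by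
  rw [sph, hem_zero, add_zero]

end Hemispheres

theorem cob_cob {X : Type*} (φ : List X → ZMod 2) (l : List X) : cob (cob φ) l = 0 := by
  induction l generalizing φ with
  | nil => rfl
  | cons v w ih =>
    simp only [cob, cob_add, ih, add_zero]
    exact CharTwo.add_self_eq_zero _

section Half

variable {Λ : Type*}

open Classical in
/-- The restriction of a function to a set of representatives of unordered pairs. -/
noncomputable def half (C : Finset Λ → Finset Λ → ZMod 2) (S T : Finset Λ) : ZMod 2 :=
  if WellOrderingRel S T then C S T else 0

theorem half_add_half (C : Finset Λ → Finset Λ → ZMod 2) {S T : Finset Λ}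
    (hC : C T S = C S T) (h : S = T → C S T = 0) : half C S T + half C T S = C S T := by
  unfold half
  rcases trichotomous_of WellOrderingRel S T with hST | hST | hST
  · rw [if_pos hST, if_neg (asymm_of WellOrderingRel hST), add_zero]
  · subst hST
    rw [if_neg (irrefl_of WellOrderingRel S), add_zero, h rfl]
  · rw [if_pos hST, if_neg (asymm_of WellOrderingRel hST), zero_add, hC]

theorem half_empty_left {C : Finset Λ → Finset Λ → ZMod 2} (h : ∀ T, C ∅ T = 0) (T : Finset Λ) :
    half C ∅ T = 0 := by
  unfold half; rw [h, ite_self]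

theorem half_empty_right {C : Finset Λ → Finset Λ → ZMod 2} (h : ∀ S, C S ∅ = 0) (S : Finset Λ) :
    half C S ∅ = 0 := by
  unfold half; rw [h, ite_self]

end Half

section Index

variable {Λ : Type*} [DecidableEq Λ]

theorem scob_add (F G : Finset Λ → ZMod 2) (S : Finset Λ) :
    scob (fun S => F S + G S) S = scob F S + scob G S :=
  Finset.sum_add_distrib

theorem scob_scob (F : Finset Λ → ZMod 2) (S : Finset Λ) : scob (scob F) S = 0 := by
  have h := cob_cob (alt F) S.toList
  rw [funext (cob_alt F), cob_alt, alt, if_pos S.nodup_toList, Finset.toList_toFinset] at h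
  exact h

/-- The coboundary on functions of pairs of finite sets. -/
def bicob (C : Finset Λ → Finset Λ → ZMod 2) (S T : Finset Λ) : ZMod 2 :=
  scob (fun S' => C S' T) S + scob (C S) T

theorem bicob_bicob (C : Finset Λ → Finset Λ → ZMod 2) (S T : Finset Λ) :
    bicob (bicob C) S T = 0 := by
  have h : scob (fun S' => scob (C S') T) S = scob (fun T' => scob (fun S' => C S' T') S) T :=
    Finset.sum_comm
  have h1 : scob (fun S' => scob (fun S'' => C S'' T) S') S = 0 := scob_scob (fun S' => C S' T) S
  have h2 : scob (fun T' => scob (C S) T') T = 0 := scob_scob (C S) T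
  unfold bicob
  rw [scob_add, scob_add, h1, h2, h, zero_add, add_zero]
  exact CharTwo.add_self_eq_zero _

/-- Cochains on pairs of disjoint finite sets representing the powers of the characteristic class
of the exchange of the two sets. -/
noncomputable def idx : ℕ → Finset Λ → Finset Λ → ZMod 2
  | 0 => fun S T => if S.card = 1 ∧ T.card = 1 then 1 else 0
  | j + 1 => bicob (half (idx j))

theorem bicob_idx (j : ℕ) (S T : Finset Λ) : bicob (idx j) S T = 0 := by
  cases j with
  | succ j => exact bicob_bicob _ S T
  | zero =>
    have h : ∀ (S : Finset Λ) (p : Prop) [Decidable p],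
        scob (fun S' => if S'.card = 1 ∧ p then (1 : ZMod 2) else 0) S = 0 := by
      intro S p _
      unfold scob
      rw [Finset.sum_congr (g := fun _ => if S.card - 1 = 1 ∧ p then (1 : ZMod 2) else 0) rfl
        fun a ha => by simp only [Finset.card_erase_of_mem ha], Finset.sum_const]
      split_ifs with hS
      · rw [show S.card = 2 by omega]; rfl
      · simp
    unfold bicob
    simp only [idx]
    rw [h]
    simp only [and_comm (a := S.card = 1)]
    rw [h, add_zero]

theorem idx_empty_left (j : ℕ) (T : Finset Λ) : idx j ∅ T = 0 := by
  induction j generalizing T with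
  | zero => simp [idx]
  | succ j ih => simp [idx, bicob, scob, half_empty_left ih]

theorem idx_empty_right (j : ℕ) (S : Finset Λ) : idx j S ∅ = 0 := by
  induction j generalizing S with
  | zero => simp [idx]
  | succ j ih => simp [idx, bicob, scob, half_empty_right ih]

theorem half_idx_of_symm {j : ℕ} {S T : Finset Λ} (h : Disjoint S T) (hs : idx j T S = idx j S T) :
    half (idx j) S T + half (idx j) T S = idx j S T := by
  refine half_add_half _ hs ?_
  rintro rfl
  rw [disjoint_self.1 h]
  exact idx_empty_left j _

theorem idx_symm (j : ℕ) {S T : Finset Λ} (h : Disjoint S T) : idx j T S = idx j S T := by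
  induction j generalizing S T with
  | zero => simp [idx, and_comm]
  | succ j ih =>
    rw [← CharTwo.add_eq_zero]
    calc idx (j + 1) T S + idx (j + 1) S T = bicob (idx j) S T := by
          simp only [idx, bicob]
          have e1 : scob (fun S' => idx j S' T) S =
              scob (fun S' => half (idx j) S' T) S + scob (half (idx j) T) S := by
            rw [← scob_add]
            refine Finset.sum_congr rfl fun a _ => ?_
            have := h.mono_left (Finset.erase_subset a S)
            exact (half_idx_of_symm this (ih this)).symm
          have e2 : scob (idx j S) T =
              scob (half (idx j) S) T + scob (fun T' => half (idx j) T' S) T := by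
            rw [← scob_add]
            refine Finset.sum_congr rfl fun a _ => ?_
            have := h.mono_right (Finset.erase_subset a T)
            exact (half_idx_of_symm this (ih this)).symm
          rw [e1, e2]; ring
      _ = 0 := bicob_idx j S T

theorem half_idx_add (j : ℕ) {S T : Finset Λ} (h : Disjoint S T) :
    half (idx j) S T + half (idx j) T S = idx j S T :=
  half_idx_of_symm h (idx_symm j h)

end Index

section Pairing

variable {X Λ : Type*} [DecidableEq Λ]

/-- The pull-back, along the map `(f, g)`, of a cochain on pairs of finite sets of labels. -/
def pairing (f g : X → Λ) (C : Finset Λ → Finset Λ → ZMod 2) (l : List X) : ZMod 2 :=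
  diag (fun s t => alt₂ C (s.map f) (t.map g)) l

theorem cob_pairing (f g : X → Λ) {C : Finset Λ → Finset Λ → ZMod 2}
    (hl : ∀ T, C ∅ T = 0) (hr : ∀ S, C S ∅ = 0) (l : List X) :
    cob (pairing f g C) l = pairing f g (bicob C) l := by
  have h := diag_cob (fun s t => alt₂ C (s.map f) (t.map g)) l
  have hb : ∀ s t : List X, cob (fun s' => alt₂ C (s'.map f) (t.map g)) s +
      cob (fun t' => alt₂ C (s.map f) (t'.map g)) t = alt₂ (bicob C) (s.map f) (t.map g) := by
    intro s t
    rw [← cob_map f (fun u => alt₂ C u (t.map g)), ← cob_map g (fun u => alt₂ C (s.map f) u),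
      cob_alt₂_left, show (fun u => alt₂ C (s.map f) u) = alt₂ C (s.map f) from rfl,
      cob_alt₂_right]
    simp only [alt₂_eq_ite, bicob]
    split_ifs <;> simp
  simp only [hb] at h
  rw [show alt₂ C (List.map f []) (List.map g l) = 0 by simp [alt₂_eq_ite, hl],
    show alt₂ C (List.map f l) (List.map g []) = 0 by simp [alt₂_eq_ite, hr], add_zero] at h
  exact (CharTwo.add_eq_zero.1 h).symm

theorem pairing_antip {V : Type*} [InvolutiveNeg V] (f g : V → Λ)
    (C : Finset Λ → Finset Λ → ZMod 2) (l : List V) :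
    pairing f g C (antip l) =
      pairing (fun x => g (-x)) (fun x => f (-x)) (fun S T => C T S) l := by
  simp only [pairing, antip, diag_reverse, diag_map, alt₂_swap]
  congr 1
  funext s t
  simp [alt₂_eq_ite, Function.comp_def]

theorem pairing_add (f g : X → Λ) (C D : Finset Λ → Finset Λ → ZMod 2) (l : List X) :
    pairing f g (fun S T => C S T + D S T) l = pairing f g C l + pairing f g D l := by
  unfold pairing
  rw [← diag_add]
  congr 1
  funext s t
  simp only [alt₂_eq_ite]
  split_ifs <;> simp

theorem pairing_congr (f g : X → Λ) {C D : Finset Λ → Finset Λ → ZMod 2} {l : List X}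
    (hl : ∀ x ∈ l, ∀ y ∈ l, f x ≠ g y) (h : ∀ S T, Disjoint S T → C S T = D S T) :
    pairing f g C l = pairing f g D l := by
  refine diag_congr _ _ _ fun s t _ hs ht => ?_
  simp only [alt₂_eq_ite]
  rw [h]
  rw [Finset.disjoint_left]
  intro a ha hb
  obtain ⟨x, hx, rfl⟩ := List.mem_map.1 (List.mem_toFinset.1 ha)
  obtain ⟨y, hy, hxy⟩ := List.mem_map.1 (List.mem_toFinset.1 hb)
  exact hl x (hs hx) y (ht hy) hxy.symm

end Pairing

section Core

variable {V Λ : Type*} [NormedAddCommGroup V] [NormedSpace ℝ V] [DecidableEq Λ]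

/-- A labelling for which antipodal labels are disjoint detects the fundamental cycle. -/
theorem sph_pairing_half_idx {e : ℕ → V} {m n : ℕ} {A : ℕ → Set V} (hm : 0 < m)
    (hA : IsConeTower e n A) (f : V → Λ)
    (hf : ∀ x ∈ A n, ∀ y ∈ A n, dist x y ≤ 2 * n / m → f x ≠ f (-y)) {j : ℕ} (hj : j ≤ n) :
    sph e m j (pairing f (fun x => f (-x)) (half (idx j))) = 1 := by
  have key : ∀ j ≤ n, sph e m j (pairing f (fun x => f (-x)) (half (idx j))) =
      hem e m j (pairing f (fun x => f (-x)) (idx j)) := by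
    intro j hj
    rw [sph, ← hem_add]
    refine hem_congr e m hm hA hj _ _ fun l hl => ?_
    simp only [pairing_antip, neg_neg]
    rw [← pairing_add]
    have hl' : IsSmall (A n) j (2 * n / m) l := hl.mono (hA.mono hj) (by gcongr)
    exact pairing_congr _ _ (fun x hx y hy => hf x (hl'.mem x hx) y (hl'.mem y hy)
      (hl'.dist_le x hx y hy)) fun S T hST => half_idx_add j hST
  induction j with
  | zero =>
    rw [key 0 hj]
    simp [hem, pairing, diag, alt₂_eq_ite, idx]
  | succ j ih =>
    rw [key _ hj, ← ih (by omega), ← hem_succ_cob e m hm]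
    congr 1
    funext l
    rw [cob_pairing _ _ (half_empty_left (idx_empty_left j))
      (half_empty_right (idx_empty_right j))]
    rfl

end Core

theorem cob_prism_comm {X Y Λ : Type*} (f g : X → Λ) (Φ : List Λ → List Y → ZMod 2) (s : List X)
    (t : List Y) :
    cob (fun t => prism f g (fun u => Φ u t) s) t = prism f g (fun u => cob (Φ u) t) s := by
  induction s generalizing Φ with
  | nil =>
    simp only [prism]
    induction t with
    | nil => rfl
    | cons v w ih => rw [cob, ih, add_zero]
  | cons v w ih => simp only [prism, cob_add, ih]

section Vanishing

variable {Λ : Type*} [DecidableEq Λ] {k : ℕ}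

theorem alt_eq_zero_of_coloring (col : Λ → Fin (k + 1)) (F : Finset Λ → ZMod 2) {u : List Λ}
    (hu : k + 1 < u.length) (hcol : ∀ a ∈ u, ∀ b ∈ u, col a = col b → a = b) : alt F u = 0 := by
  rw [alt, if_neg]
  intro hn
  have h := (List.Nodup.map_on hcol hn).length_le_card
  rw [List.length_map, Fintype.card_fin] at h
  omega

end Vanishing

section Compatible

variable {V Λ : Type*} [NormedAddCommGroup V] {k : ℕ}

/-- Two labellings by a coloured set such that the labels of nearby points are determined by
their colours. -/
def Compatible (col : Λ → Fin (k + 1)) (A : Set V) (d : ℝ) (f g : V → Λ) : Prop :=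
  ∀ x ∈ A, ∀ y ∈ A, dist x y ≤ d → ∀ a, (a = f x ∨ a = g x) → ∀ b, (b = f y ∨ b = g y) →
    col a = col b → a = b

theorem Compatible.comp_neg {col : Λ → Fin (k + 1)} {A : Set V} {d : ℝ} {f g : V → Λ}
    (h : Compatible col A d f g) (hA : ∀ x ∈ A, -x ∈ A) :
    Compatible col A d (fun x => f (-x)) (fun x => g (-x)) :=
  fun x hx y hy hxy => h (-x) (hA x hx) (-y) (hA y hy) (by rwa [dist_neg_neg])

theorem Compatible.left {col : Λ → Fin (k + 1)} {A : Set V} {d : ℝ} {f g : V → Λ}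
    (h : Compatible col A d f g) : Compatible col A d f f :=
  fun x hx y hy hxy a ha b hb => h x hx y hy hxy a (Or.inl (by simpa using ha)) b
    (Or.inl (by simpa using hb))

end Compatible

section Deformation

variable {V Λ : Type*} [NormedAddCommGroup V] [NormedSpace ℝ V] [DecidableEq Λ] {k : ℕ}

/-- In the top dimension, contiguous labellings have the same value on the fundamental cycle. -/
theorem sph_pairing_eq_of_compatible {e : ℕ → V} {m : ℕ} {A : ℕ → Set V} (hm : 0 < m)
    (hA : IsConeTower e (2 * k) A) (col : Λ → Fin (k + 1)) {f f' g : V → Λ}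
    (hf : Compatible col (A (2 * k)) (2 * (2 * k : ℕ) / m) f f')
    (hg : Compatible col (A (2 * k)) (2 * (2 * k : ℕ) / m) g g)
    (C : Finset Λ → Finset Λ → ZMod 2) :
    sph e m (2 * k) (pairing f g C) = sph e m (2 * k) (pairing f' g C) := by
  set W : List V → List V → ZMod 2 := fun s t => prism f f' (fun u => alt₂ C u (t.map g)) s with hW
  have key : ∀ l, IsSmall (A (2 * k)) (2 * k) (2 * (2 * k : ℕ) / m) l →
      cob (diag W) l = pairing f g C l + pairing f' g C l := by
    intro l hl
    have hlong : ∀ s ⊆ l, ∀ F : Finset Λ → ZMod 2, k + 1 ≤ s.length → prism f f' (alt F) s = 0 := by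
      intro s hs F hlen
      refine prism_eq_zero _ _ _ _ fun u hu hmem =>
        alt_eq_zero_of_coloring col F (by omega) fun a ha b hb => ?_
      obtain ⟨x, hx, hxa⟩ := hmem a ha
      obtain ⟨y, hy, hyb⟩ := hmem b hb
      exact hf x (hl.mem x (hs hx)) y (hl.mem y (hs hy)) (hl.dist_le x (hs hx) y (hs hy))
        a hxa b hyb
    have hlong' : ∀ t ⊆ l, ∀ F : Finset Λ → ZMod 2, k + 2 ≤ t.length → alt F (t.map g) = 0 := by
      intro t ht F hlen
      refine alt_eq_zero_of_coloring col F (by simp; omega) fun a ha b hb => ?_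
      obtain ⟨x, hx, rfl⟩ := List.mem_map.1 ha
      obtain ⟨y, hy, rfl⟩ := List.mem_map.1 hb
      exact hg x (hl.mem x (ht hx)) y (hl.mem y (ht hy)) (hl.dist_le x (ht hx) y (ht hy)) _
        (Or.inl rfl) _ (Or.inl rfl)
    have hprism0 : ∀ s : List V, prism f f' (fun _ => (0 : ZMod 2)) s = 0 :=
      fun s => prism_eq_zero _ _ _ _ fun _ _ _ => rfl
    have hbdry : ∀ s t : List V, s.length + t.length = l.length + 1 → s ⊆ l → t ⊆ l →
        cob (fun s' => W s' t) s + cob (W s) t =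
          alt₂ C (s.map f) (t.map g) + alt₂ C (s.map f') (t.map g) := by
      intro s t hst hs ht
      rw [hl.length] at hst
      have h1 := prism_homotopy f f' (fun u => alt₂ C u (t.map g)) s
      have h2 : cob (W s) t
          = prism f f' (fun u => alt₂ (fun S T => scob (C S) T) u (t.map g)) s := by
        rw [hW, cob_prism_comm f f' (fun u t => alt₂ C u (t.map g))]
        congr 1
        funext u
        rw [← cob_map g (fun v => alt₂ C u v), ← cob_alt₂_right]
      have h3 : cob (fun u => alt₂ C u (t.map g)) =
          fun u => alt₂ (fun S T => scob (fun S' => C S' T) S) u (t.map g) :=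
        funext fun u => cob_alt₂_left C u (t.map g)
      have h4 : ∀ D : Finset Λ → Finset Λ → ZMod 2,
          prism f f' (fun u => alt₂ D u (t.map g)) s = 0 := by
        intro D
        by_cases hlen : k + 1 ≤ s.length
        · exact hlong s hs _ hlen
        · simp only [alt₂, hlong' t ht _ (show k + 2 ≤ t.length by omega)]
          exact prism_eq_zero _ _ _ _ fun u _ _ => by simp [alt]
      rw [h3, h4, zero_add] at h1
      rw [h2, h4, add_zero, h1]
    have h := diag_cob W l
    rw [diag_congr _ _ l hbdry, diag_add] at h
    have hW1 : W [] l = 0 := rfl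
    have hW2 : W l [] = 0 := hlong l (List.Subset.refl l) _ (by rw [hl.length]; omega)
    rw [hW1, hW2, add_zero] at h
    exact (CharTwo.add_eq_zero.1 h).symm
  have h := sph_congr e m hm hA le_rfl _ _ key
  rw [sph_cob e m hm, sph_add] at h
  exact CharTwo.add_eq_zero.1 h.symm

/-- There is no labelling of the sphere of dimension `2 * k` by a set with `k + 1` colours, with
disjoint antipodal labels, which deforms to a labelling that is constant on a set `U` such that `U`
and `-U` cover the sphere. -/
theorem no_deformable_labelling (hk : 1 ≤ k) {e : ℕ → V} {m : ℕ} {A : ℕ → Set V} (hm : 0 < m)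
    (hA : IsConeTower e (2 * k) A) (col : Λ → Fin (k + 1)) (lab : ℕ → V → Λ)
    (hcol : ∀ i, Compatible col (A (2 * k)) (2 * (2 * k : ℕ) / m) (lab i) (lab (i + 1)))
    (hdisj : ∀ x ∈ A (2 * k), ∀ y ∈ A (2 * k), dist x y ≤ 2 * (2 * k : ℕ) / m →
      lab 0 x ≠ lab 0 (-y))
    (q : ℕ) (U : Set V) (hconst : ∀ x ∈ U, ∀ y ∈ U, lab q x = lab q y)
    (hcover : ∀ l, IsSmall (A (2 * k)) (2 * k) (2 * (2 * k : ℕ) / m) l →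
      (∀ x ∈ l, x ∈ U) ∨ ∀ x ∈ l, -x ∈ U) : False := by
  have step : ∀ (g : V → Λ) (C : Finset Λ → Finset Λ → ZMod 2),
      Compatible col (A (2 * k)) (2 * (2 * k : ℕ) / m) g g → ∀ i,
      sph e m (2 * k) (pairing (lab 0) g C) = sph e m (2 * k) (pairing (lab i) g C) := by
    intro g C hg i
    induction i with
    | zero => rfl
    | succ i ih => rw [ih]; exact sph_pairing_eq_of_compatible hm hA col (hcol i) hg C
  have hneg : ∀ i, Compatible col (A (2 * k)) (2 * (2 * k : ℕ) / m) (fun x => lab i (-x))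
      (fun x => lab i (-x)) := fun i => (hcol i).left.comp_neg (hA.neg_mem _)
  have hswap : ∀ i i' (C : Finset Λ → Finset Λ → ZMod 2),
      sph e m (2 * k) (pairing (lab i) (fun x => lab i' (-x)) C) =
        sph e m (2 * k) (pairing (lab i') (fun x => lab i (-x)) (fun S T => C T S)) := by
    intro i i' C
    rw [← sph_antip]
    simp only [pairing_antip, neg_neg]
  have h1 := sph_pairing_half_idx hm hA (lab 0) hdisj (le_refl (2 * k))
  rw [step _ _ (hneg 0) q, hswap, step _ _ (hneg q) q] at h1
  rw [sph_congr e m hm hA le_rfl _ (fun _ => 0), sph_zero] at h1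
  · exact zero_ne_one h1
  intro l hl
  rw [← diag_zero l]
  refine diag_congr _ _ l fun s t hst hs ht => ?_
  rw [hl.length] at hst
  have hnodup : ∀ (h : V → Λ) (s : List V), 2 ≤ s.length → (∀ x ∈ s, ∀ y ∈ s, h x = h y) →
      ¬ (s.map h).Nodup := by
    rintro h (_ | ⟨a, _ | ⟨b, s⟩⟩) hlen hs hn
    · simp at hlen
    · simp at hlen
    · rw [List.map_cons, List.map_cons, hs a (by simp) b (by simp)] at hn
      simp at hn
  have hlong : ∀ (h : V → Λ) (s : List V), s ⊆ l →
      Compatible col (A (2 * k)) (2 * (2 * k : ℕ) / m) h h → k + 2 ≤ s.length →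
      ¬ (s.map h).Nodup := by
    intro h s hs hh hlen hn
    have := alt_eq_zero_of_coloring col (fun _ => 1) (u := s.map h) (by simp; omega)
      fun a ha b hb => by
        obtain ⟨x, hx, rfl⟩ := List.mem_map.1 ha
        obtain ⟨y, hy, rfl⟩ := List.mem_map.1 hb
        exact hh x (hl.mem x (hs hx)) y (hl.mem y (hs hy)) (hl.dist_le x (hs hx) y (hs hy)) _
          (Or.inl rfl) _ (Or.inl rfl)
    rw [alt, if_pos hn] at this
    exact one_ne_zero this
  rw [alt₂_eq_ite, if_neg]
  rintro ⟨hns, hnt⟩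
  have hs2 : ¬ k + 2 ≤ s.length := fun h => hlong _ s hs (hcol q).left h hns
  have ht2 : ¬ k + 2 ≤ t.length := fun h => hlong _ t ht (hneg q) h hnt
  rcases hcover l hl with h | h
  · exact hnodup _ s (by omega)
      (fun x hx y hy => hconst x (h x (hs hx)) y (h y (hs hy))) hns
  · exact hnodup _ t (by omega)
      (fun x hx y hy => hconst _ (h x (ht hx)) _ (h y (ht hy))) hnt

end Deformation

open Module

/-- A compact set in a countable union of affine subspaces of dimension less than `k` has
labellings with small fibres using `k` colours, where nearby points of the same colour have
the same label. -/
theorem exists_colored_labelling {M : ℕ} (k : ℕ) (𝓕 : Set (AffineSubspace ℝ (Fin M → ℝ)))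
    (h𝓕 : 𝓕.Countable)
    (hdim : ∀ F ∈ 𝓕, (F : Set (Fin M → ℝ)).Nonempty → finrank ℝ F.direction < k)
    {Y : Set (Fin M → ℝ)} (hY : IsCompact Y) (hYF : ∀ y ∈ Y, ∃ F ∈ 𝓕, y ∈ F)
    {ε : ℝ} (hε : 0 < ε) :
    ∃ (U : Set (Fin M → ℝ)) (lab : (Fin M → ℝ) → ℕ × (Fin M → ℤ)) (ρ : ℝ),
      IsOpen U ∧ Y ⊆ U ∧ 0 < ρ ∧ (∀ x ∈ U, (lab x).1 < k) ∧
      (∀ x ∈ U, ∀ y ∈ U, lab x = lab y → dist x y < ε) ∧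
      ∀ x ∈ U, ∀ y ∈ U, dist x y < ρ → (lab x).1 = (lab y).1 → lab x = lab y := by
  classical
  induction k generalizing 𝓕 Y with
  | zero =>
    refine ⟨∅, fun _ => (0, 0), 1, isOpen_empty, fun y hy => ?_, one_pos, by simp, by simp, by simp⟩
    obtain ⟨F, hF, hyF⟩ := hYF y hy
    exact absurd (hdim F hF ⟨y, hyF⟩) (by simp)
  | succ k ih =>
    set s : ℝ := ε / 2 with hs
    have hs0 : 0 < s := half_pos hε
    obtain ⟨c, hc⟩ : ∃ c : ℝ, ∀ F ∈ 𝓕, (F : Set (Fin M → ℝ)).Nonempty → ∀ (i : Fin M) (z : ℤ),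
        ¬ ∀ x ∈ F, x i = c + s * z := by
      have hcount : (⋃ F ∈ 𝓕, ⋃ i : Fin M, ⋃ z : ℤ,
          {c : ℝ | (F : Set (Fin M → ℝ)).Nonempty ∧ ∀ x ∈ F, x i = c + s * z}).Countable := by
        refine h𝓕.biUnion fun F _ => Set.countable_iUnion fun i => Set.countable_iUnion fun z => ?_
        refine Set.Subsingleton.countable ?_
        rintro a ⟨⟨x, hx⟩, ha⟩ b ⟨-, hb⟩
        linarith [ha x hx, hb x hx]
      obtain ⟨c, hc⟩ := (hcount.dense_compl ℝ).nonempty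
      refine ⟨c, fun F hF hne i z h => hc ?_⟩
      simp only [Set.mem_iUnion]
      exact ⟨F, hF, i, z, hne, h⟩
    let H : Fin M → ℤ → AffineSubspace ℝ (Fin M → ℝ) := fun i z =>
      AffineSubspace.mk' (fun _ => c + s * z) (LinearMap.ker (LinearMap.proj i))
    have hH : ∀ i z x, x ∈ H i z ↔ x i = c + s * z := by
      intro i z x
      simp [H, AffineSubspace.mem_mk', sub_eq_zero]
    let box : (Fin M → ℤ) → Set (Fin M → ℝ) := fun z =>
      {x | ∀ i, (z i : ℝ) < (x i - c) / s ∧ (x i - c) / s < z i + 1}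
    let idx : (Fin M → ℝ) → Fin M → ℤ := fun x i => ⌊(x i - c) / s⌋
    have hbox : ∀ z, IsOpen (box z) := by
      intro z
      simp only [box, Set.ofPred_forall]
      refine isOpen_iInter_of_finite fun i => ?_
      have h : Continuous fun x : Fin M → ℝ => (x i - c) / s := by fun_prop
      exact (isOpen_lt continuous_const h).inter (isOpen_lt h continuous_const)
    have hidx : ∀ z, ∀ x ∈ box z, idx x = z := by
      intro z x hx
      funext i
      exact Int.floor_eq_iff.2 ⟨(hx i).1.le, (hx i).2⟩
    have hgrid : ∀ x ∉ ⋃ z, box z, ∃ i z, x ∈ H i z := by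
      intro x hx
      by_contra! hcon
      refine hx (Set.mem_iUnion.2 ⟨idx x, fun i => ⟨lt_of_le_of_ne (Int.floor_le _) ?_,
        Int.lt_floor_add_one _⟩⟩)
      intro heq
      refine hcon i (idx x i) ((hH _ _ _).2 ?_)
      simp only [idx] at heq ⊢
      rw [heq]
      field_simp
      ring
    have hopen : IsOpen (⋃ z, box z) := isOpen_iUnion hbox
    obtain ⟨U, lab, ρ, hU, hYU, hρ, hlt, hfib, hnear⟩ := ih
      (⋃ F ∈ 𝓕, ⋃ i : Fin M, ⋃ z : ℤ, {F ⊓ H i z})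
      (h𝓕.biUnion fun F _ => Set.countable_iUnion fun i => Set.countable_iUnion fun z =>
        Set.countable_singleton _)
      (by
        intro F' hF' hne
        simp only [Set.mem_iUnion, Set.mem_singleton_iff] at hF'
        obtain ⟨F, hF, i, z, rfl⟩ := hF'
        have hneF : (F : Set (Fin M → ℝ)).Nonempty := hne.mono (inf_le_left (a := F))
        have hlt : F ⊓ H i z < F := by
          refine lt_of_le_of_ne inf_le_left fun heq => hc F hF hneF i z fun x hx => ?_
          rw [← heq] at hx
          exact (hH _ _ _).1 hx.2
        have := Submodule.finrank_lt_finrank_of_lt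
          (AffineSubspace.direction_lt_of_nonempty hlt hne)
        have := hdim F hF hneF
        omega)
      (Y := Y \ ⋃ z, box z) (hY.diff hopen)
      (by
        rintro y ⟨hy, hyb⟩
        obtain ⟨F, hF, hyF⟩ := hYF y hy
        obtain ⟨i, z, hz⟩ := hgrid y hyb
        refine ⟨F ⊓ H i z, ?_, hyF, hz⟩
        simp only [Set.mem_iUnion, Set.mem_singleton_iff]
        exact ⟨F, hF, i, z, rfl⟩)
    obtain ⟨δ, hδ, hleb⟩ := lebesgue_number_lemma_of_metric (hY.diff hU) hbox
      (fun y hy => by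
        by_contra h
        exact hy.2 (hYU ⟨hy.1, h⟩))
    have hδ2 : 0 < δ / 2 := half_pos hδ
    have hex : ∀ x ∈ U ∪ ⋃ y ∈ Y \ U, Metric.ball y (δ / 2), x ∉ U →
        ∃ y z, dist x y < δ / 2 ∧ Metric.ball y δ ⊆ box z := by
      rintro x (hx | hx) hxU
      · exact absurd hx hxU
      · simp only [Set.mem_iUnion] at hx
        obtain ⟨y, hy, hxy⟩ := hx
        obtain ⟨z, hz⟩ := hleb y hy
        exact ⟨y, z, hxy, hz⟩
    refine ⟨U ∪ ⋃ y ∈ Y \ U, Metric.ball y (δ / 2), fun x => if x ∈ U then lab x else (k, idx x),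
      min ρ (δ / 2), hU.union (isOpen_biUnion fun _ _ => Metric.isOpen_ball), ?_,
      lt_min hρ hδ2, ?_, ?_, ?_⟩
    · intro y hy
      by_cases hyU : y ∈ U
      · exact Or.inl hyU
      · exact Or.inr (Set.mem_biUnion (show y ∈ Y \ U from ⟨hy, hyU⟩) (Metric.mem_ball_self hδ2))
    · intro x _
      dsimp only
      split_ifs with hxU
      · exact (hlt x hxU).trans k.lt_succ_self
      · exact k.lt_succ_self
    · intro x _ y _ hxy
      dsimp only at hxy
      split_ifs at hxy with hxU hyU hyU
      · exact hfib x hxU y hyU hxy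
      · exact absurd (congrArg Prod.fst hxy) (hlt x hxU).ne
      · exact absurd (congrArg Prod.fst hxy) (hlt y hyU).ne'
      · refine lt_of_le_of_lt ((dist_pi_le_iff hs0.le).2 fun i => ?_) (half_lt_self hε)
        have h := congrFun (congrArg Prod.snd hxy) i
        have h1 := Int.abs_sub_lt_one_of_floor_eq_floor h
        rw [← sub_div, abs_div, abs_of_pos hs0, div_lt_one hs0] at h1
        rw [Real.dist_eq]
        rw [sub_sub_sub_cancel_right] at h1
        exact h1.le
    · intro x hx y hy hxy hcol
      dsimp only at hcol ⊢
      split_ifs at hcol ⊢ with hxU hyU hyU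
      · exact hnear x hxU y hyU (hxy.trans_le (min_le_left _ _)) hcol
      · exact absurd hcol (hlt x hxU).ne
      · exact absurd hcol (hlt y hyU).ne'
      · obtain ⟨p, z, hp, hz⟩ := hex x hx hxU
        have hyp : dist y p < δ := by
          have := dist_triangle_left y p x
          have := hxy.trans_le (min_le_right _ _)
          linarith
        rw [hidx z x (hz (hp.trans (half_lt_self hδ))), hidx z y (hz hyp)]

section CrossPolytope

variable {N : ℕ}

/-- The boundary of the `j + 1`-dimensional cross-polytope in the span of the first `j + 1`
coordinates. -/
def crossSphere (N j : ℕ) : Set (Fin N → ℝ) :=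
  {x | ∑ i, |x i| = 1 ∧ ∀ i : Fin N, j < i → x i = 0}

/-- The `j`-th standard basis vector. -/
def basisVec (N j : ℕ) : Fin N → ℝ := fun i => if (i : ℕ) = j then 1 else 0

theorem sum_basisVec {j : ℕ} (hj : j < N) : ∑ i, basisVec N j i = 1 := by
  rw [Finset.sum_eq_single (⟨j, hj⟩ : Fin N)]
  · simp [basisVec]
  · intro i _ hi
    exact if_neg fun h => hi (Fin.ext h)
  · simp

theorem isConeTower_crossSphere {n : ℕ} (hn : n < N) :
    IsConeTower (basisVec N) n (crossSphere N) where
  neg_mem j x hx := ⟨by simpa using hx.1, fun i hi => by simp [hx.2 i hi]⟩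
  norm_le j x hx := by
    refine (pi_norm_le_iff_of_nonneg zero_le_one).2 fun i => ?_
    rw [Real.norm_eq_abs, ← hx.1]
    exact Finset.single_le_sum (f := fun i => |x i|) (fun _ _ => abs_nonneg _) (Finset.mem_univ i)
  vertex_mem j hj := by
    refine ⟨?_, fun i hi => if_neg hi.ne'⟩
    rw [← sum_basisVec (hj.trans_lt hn)]
    refine Finset.sum_congr rfl fun i _ => abs_of_nonneg ?_
    unfold basisVec; split_ifs <;> norm_num
  cone_mem j hj x hx t ht0 ht1 := by
    have h : ∀ i, |((1 - t) • x + t • basisVec N (j + 1)) i| =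
        (1 - t) * |x i| + t * basisVec N (j + 1) i := by
      intro i
      simp only [Pi.add_apply, Pi.smul_apply, smul_eq_mul, basisVec]
      split_ifs with hi
      · simp [hx.2 i (by omega), abs_of_nonneg ht0]
      · simp [abs_mul, abs_of_nonneg (sub_nonneg.2 ht1)]
    refine ⟨?_, fun i hi => ?_⟩
    · simp only [h]
      rw [Finset.sum_add_distrib, ← Finset.mul_sum, ← Finset.mul_sum, hx.1,
        sum_basisVec (by omega)]
      ring
    · simp [hx.2 i (by omega), basisVec, hi.ne']
  mono j j' hjj' x hx := ⟨hx.1, fun i hi => hx.2 i (by omega)⟩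

theorem isCompact_crossSphere (j : ℕ) : IsCompact (crossSphere N j) := by
  refine Metric.isCompact_of_isClosed_isBounded ?_ ?_
  · have h : Continuous fun x : Fin N → ℝ => ∑ i, |x i| := by fun_prop
    have h2 : IsClosed {x : Fin N → ℝ | ∀ i : Fin N, j < i → x i = 0} := by
      simp only [Set.ofPred_forall]
      exact isClosed_iInter fun i => isClosed_iInter fun _ =>
        isClosed_eq (continuous_apply i) continuous_const
    exact (isClosed_eq h continuous_const).inter h2
  · refine (Metric.isBounded_iff_subset_closedBall 0).2 ⟨1, fun x hx => ?_⟩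
    rw [mem_closedBall_zero_iff]
    refine (pi_norm_le_iff_of_nonneg zero_le_one).2 fun i => ?_
    rw [Real.norm_eq_abs, ← hx.1]
    exact Finset.single_le_sum (f := fun i => |x i|) (fun _ _ => abs_nonneg _) (Finset.mem_univ i)

theorem ne_zero_of_mem_crossSphere {j : ℕ} {x : Fin N → ℝ} (hx : x ∈ crossSphere N j) : x ≠ 0 := by
  rintro rfl
  simpa using hx.1

/-- A deformation of the cross-polytope collapsing a neighbourhood of a half of it. -/
noncomputable def collapse (i₀ : Fin N) (t : ℝ) (x : Fin N → ℝ) : Fin N → ℝ :=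
  ((1 - t) + t * max 0 (x i₀ - 1 / 4)) • x - (t * max 0 (1 / 2 - x i₀)) • basisVec N i₀

theorem collapse_zero (i₀ : Fin N) (x : Fin N → ℝ) : collapse i₀ 0 x = x := by
  simp [collapse]

theorem collapse_one (i₀ : Fin N) {x : Fin N → ℝ} (hx : x i₀ ≤ 1 / 4) :
    collapse i₀ 1 x = (1 / 2 - x i₀) • -basisVec N i₀ := by
  rw [collapse, max_eq_left (by linarith), max_eq_right (by linarith)]
  simp

theorem collapse_ne_zero (i₀ : Fin N) {t : ℝ} (ht0 : 0 ≤ t) (ht1 : t ≤ 1) {j : ℕ} {x : Fin N → ℝ}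
    (hx : x ∈ crossSphere N j) : collapse i₀ t x ≠ 0 := by
  intro h
  have hc0 : 0 ≤ (1 - t) + t * max 0 (x i₀ - 1 / 4) := by
    have := mul_nonneg ht0 (le_max_left 0 (x i₀ - 1 / 4))
    linarith
  have hcoord : ∀ i, ((1 - t) + t * max 0 (x i₀ - 1 / 4)) * x i =
      (t * max 0 (1 / 2 - x i₀)) * basisVec N i₀ i := by
    intro i
    have := congrFun h i
    simp only [collapse, Pi.sub_apply, Pi.smul_apply, smul_eq_mul, Pi.zero_apply] at this
    linarith
  have h0 := hcoord i₀
  rw [show basisVec N i₀ i₀ = 1 from if_pos rfl, mul_one] at h0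
  rcases hc0.eq_or_lt with hc | hc
  · rw [← hc, zero_mul] at h0
    have h1 := mul_nonneg ht0 (le_max_left 0 (x i₀ - 1 / 4))
    have ht : t = 1 := by linarith
    subst ht
    have h2 : x i₀ - 1 / 4 ≤ 0 := by
      have := le_max_right 0 (x i₀ - 1 / 4)
      linarith
    have := le_max_right 0 (1 / 2 - x i₀)
    linarith
  · have hz : ∀ i ≠ i₀, x i = 0 := by
      intro i hi
      have := hcoord i
      rw [show basisVec N i₀ i = 0 from if_neg fun h => hi (Fin.ext h), mul_zero] at this
      exact (mul_eq_zero.1 this).resolve_left hc.ne'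
    have hx0 : 0 ≤ x i₀ := by
      by_contra! hneg
      have := mul_neg_of_pos_of_neg hc hneg
      have := mul_nonneg ht0 (le_max_left 0 (1 / 2 - x i₀))
      linarith
    have hx1 : x i₀ = 1 := by
      have := hx.1
      rwa [Finset.sum_eq_single i₀ (fun i _ hi => by rw [hz i hi, abs_zero]) (by simp),
        abs_of_nonneg hx0] at this
    rw [hx1, max_eq_left (show (1 / 2 - 1 : ℝ) ≤ 0 by norm_num)] at h0
    rw [hx1] at hc
    linarith

theorem continuous_collapse (i₀ : Fin N) :
    Continuous fun p : ℝ × (Fin N → ℝ) => collapse i₀ p.1 p.2 := by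
  unfold collapse
  fun_prop

end CrossPolytope

/-- A positively homogeneous map of `ℝ^(2k+1) ∖ 0` to a compact set contained in a countable union
of `k`-dimensional affine subspaces identifies some pair of antipodal points. -/
theorem exists_antipodal_coincidence {k N M : ℕ} (hk : 1 ≤ k) (hN : N = 2 * k + 1)
    (𝓕 : Set (AffineSubspace ℝ (Fin M → ℝ))) (h𝓕 : 𝓕.Countable)
    (hdim : ∀ F ∈ 𝓕, (F : Set (Fin M → ℝ)).Nonempty → finrank ℝ F.direction < k + 1)
    {Y : Set (Fin M → ℝ)} (hY : IsCompact Y) (hYF : ∀ y ∈ Y, ∃ F ∈ 𝓕, y ∈ F)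
    (γ : (Fin N → ℝ) → Fin M → ℝ) (hγ : ContinuousOn γ {0}ᶜ) (hγY : ∀ x ≠ 0, γ x ∈ Y)
    (hγhom : ∀ x ≠ 0, ∀ c : ℝ, 0 < c → γ (c • x) = γ x) :
    ∃ x ≠ 0, γ x = γ (-x) := by
  classical
  by_contra! hne
  set A := crossSphere N with hAdef
  have hA : IsConeTower (basisVec N) (2 * k) A := isConeTower_crossSphere (by omega)
  have hAc : IsCompact (A (2 * k)) := isCompact_crossSphere _
  have hA0 : ∀ x ∈ A (2 * k), x ≠ 0 := fun x hx => ne_zero_of_mem_crossSphere hx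
  obtain ⟨ε, hε, hεle⟩ : ∃ ε > 0, ∀ x ∈ A (2 * k), ε ≤ dist (γ x) (γ (-x)) := by
    have hcont : ContinuousOn (fun x => dist (γ x) (γ (-x))) (A (2 * k)) := by
      have h1 : ContinuousOn γ (A (2 * k)) := hγ.mono fun x hx => hA0 x hx
      have h2 : ContinuousOn (fun x => γ (-x)) (A (2 * k)) :=
        hγ.comp continuous_neg.continuousOn fun x hx => neg_ne_zero.2 (hA0 x hx)
      exact continuous_dist.comp_continuousOn (h1.prodMk h2)
    obtain ⟨x, hx, hmin⟩ := hAc.exists_isMinOn ⟨_, hA.vertex_mem _ le_rfl⟩ hcont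
    exact ⟨_, dist_pos.2 (hne x (hA0 x hx)), fun y hy => hmin hy⟩
  obtain ⟨U, ℓ, ρ, -, hYU, hρ, hlt, hfib, hnear⟩ :=
    exists_colored_labelling (k + 1) 𝓕 h𝓕 hdim hY hYF (half_pos hε)
  set i₀ : Fin N := ⟨0, by omega⟩ with hi₀
  set G : ℝ × (Fin N → ℝ) → Fin M → ℝ := fun p => γ (collapse i₀ p.1 p.2) with hG
  have hGne : ∀ p ∈ Set.Icc (0 : ℝ) 1 ×ˢ A (2 * k), collapse i₀ p.1 p.2 ≠ 0 :=
    fun p hp => collapse_ne_zero i₀ hp.1.1 hp.1.2 hp.2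
  have hGc : ContinuousOn G (Set.Icc (0 : ℝ) 1 ×ˢ A (2 * k)) :=
    hγ.comp (continuous_collapse i₀).continuousOn hGne
  have hGu := (isCompact_Icc.prod hAc).uniformContinuousOn_of_continuous hGc
  obtain ⟨δ, hδ, hGδ⟩ := Metric.uniformContinuousOn_iff.1 hGu (min ρ (ε / 2))
    (lt_min hρ (half_pos hε))
  obtain ⟨q, hq⟩ := exists_nat_gt (1 / δ)
  have hq0 : (0 : ℝ) < q := (by positivity : (0 : ℝ) < 1 / δ).trans hq
  have hqδ : 1 / (q : ℝ) < δ := by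
    rw [div_lt_iff₀ hq0, mul_comm]; exact (div_lt_iff₀ hδ).1 hq
  have hr : 0 < min δ (1 / 2) := lt_min hδ (by norm_num)
  obtain ⟨m, hm⟩ := exists_nat_gt (2 * (2 * k : ℕ) / min δ (1 / 2))
  have hm0' : (0 : ℝ) < m := lt_of_le_of_lt (by positivity) hm
  have hm0 : 0 < m := by exact_mod_cast hm0'
  have hmr : 2 * ((2 * k : ℕ) : ℝ) / m < min δ (1 / 2) := by
    have := (div_lt_iff₀ hr).1 hm
    rw [div_lt_iff₀ hm0']
    linarith
  set τ : ℕ → ℝ := fun i => min (i / q) 1 with hτ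
  have hτmem : ∀ i, τ i ∈ Set.Icc (0 : ℝ) 1 :=
    fun i => ⟨le_min (by positivity) zero_le_one, min_le_right _ _⟩
  have hτsucc : ∀ i, |τ i - τ (i + 1)| < δ := by
    intro i
    refine lt_of_le_of_lt ?_ hqδ
    refine (abs_min_sub_min_le_max _ _ _ _).trans ?_
    rw [sub_self, abs_zero, ← sub_div]
    refine max_le ?_ (by positivity)
    rw [abs_div, abs_of_pos hq0]
    simp
  have hGU : ∀ i, ∀ x ∈ A (2 * k), G (τ i, x) ∈ U :=
    fun i x hx => hYU (hγY _ (hGne (τ i, x) ⟨hτmem i, hx⟩))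
  set lab : ℕ → (Fin N → ℝ) → ℕ × (Fin M → ℤ) := fun i x => ℓ (G (τ i, x)) with hlab
  have hG0 : ∀ x, G (τ 0, x) = γ x := fun x => by simp [hG, hτ, collapse_zero]
  let emb : ℕ × (Fin M → ℤ) → Fin (k + 1) × (Fin M → ℤ) := fun a => (Fin.ofNat (k + 1) a.1, a.2)
  have hemb : ∀ y ∈ U, ∀ y' ∈ U, (emb (ℓ y)).1 = (emb (ℓ y')).1 → (ℓ y).1 = (ℓ y').1 := by
    intro y hy y' hy' h
    have := congrArg Fin.val h
    simpa [emb, Fin.ofNat, Nat.mod_eq_of_lt (hlt y hy), Nat.mod_eq_of_lt (hlt y' hy')] using this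
  refine no_deformable_labelling hk hm0 hA (Prod.fst : Fin (k + 1) × (Fin M → ℤ) → Fin (k + 1))
    (fun i x => emb (lab i x)) ?_ ?_ q {x | x ∈ A (2 * k) ∧ x i₀ ≤ 1 / 4} ?_ ?_
  · intro i x hx y hy hxy a ha b hb hab
    obtain ⟨i₁, hi₁, rfl⟩ : ∃ i₁, (i₁ = i ∨ i₁ = i + 1) ∧ a = emb (lab i₁ x) := by
      rcases ha with rfl | rfl
      exacts [⟨i, Or.inl rfl, rfl⟩, ⟨i + 1, Or.inr rfl, rfl⟩]
    obtain ⟨i₂, hi₂, rfl⟩ : ∃ i₂, (i₂ = i ∨ i₂ = i + 1) ∧ b = emb (lab i₂ y) := by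
      rcases hb with rfl | rfl
      exacts [⟨i, Or.inl rfl, rfl⟩, ⟨i + 1, Or.inr rfl, rfl⟩]
    have ht : |τ i₁ - τ i₂| < δ := by
      rcases hi₁ with rfl | rfl <;> rcases hi₂ with rfl | rfl
      · simpa using hδ
      · exact hτsucc _
      · rw [abs_sub_comm]; exact hτsucc _
      · simpa using hδ
    have hd : dist (G (τ i₁, x)) (G (τ i₂, y)) < min ρ (ε / 2) := by
      refine hGδ _ ⟨hτmem _, hx⟩ _ ⟨hτmem _, hy⟩ ?_
      exact max_lt ht (lt_of_le_of_lt hxy (hmr.trans_le (min_le_left _ _)))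
    congr 1
    exact hnear _ (hGU _ _ hx) _ (hGU _ _ hy) (hd.trans_le (min_le_left _ _))
      (hemb _ (hGU _ _ hx) _ (hGU _ _ hy) hab)
  · intro x hx y hy hxy heq
    have hx' := hA.neg_mem _ x hx
    have hy' := hA.neg_mem _ y hy
    have h1 : ℓ (G (τ 0, x)) = ℓ (G (τ 0, -y)) :=
      Prod.ext (hemb _ (hGU _ _ hx) _ (hGU _ _ hy') (congrArg Prod.fst heq))
        (by have h := congrArg Prod.snd heq; exact h)
    have h2 := hfib _ (hGU _ _ hx) _ (hGU _ _ hy') h1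
    have h3 : dist (G (τ 0, -x)) (G (τ 0, -y)) < min ρ (ε / 2) := by
      refine hGδ _ ⟨hτmem _, hx'⟩ _ ⟨hτmem _, hy'⟩ ?_
      refine max_lt (by simpa using hδ) ?_
      simp only [dist_neg_neg]
      exact lt_of_le_of_lt hxy (hmr.trans_le (min_le_left _ _))
    rw [hG0, hG0] at h2 h3
    have h4 := hεle x hx
    have h5 := dist_triangle_right (γ x) (γ (-x)) (γ (-y))
    have h6 := h3.trans_le (min_le_right _ _)
    linarith
  · have hconst : ∀ x ∈ {x | x ∈ A (2 * k) ∧ x i₀ ≤ 1 / 4},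
        G (τ q, x) = γ (-basisVec N i₀) := by
      rintro x ⟨hx, hx4⟩
      have h1 : τ q = 1 := by simp [hτ, hq0.ne']
      simp only [hG, h1, collapse_one i₀ hx4]
      refine hγhom _ ?_ _ (by linarith)
      exact neg_ne_zero.2 (ne_zero_of_mem_crossSphere (hA.vertex_mem 0 (Nat.zero_le _)))
    intro x hx y hy
    simp only [hlab, hconst x hx, hconst y hy]
  · intro l hl
    by_cases h : ∀ x ∈ l, x i₀ ≤ 1 / 4
    · exact Or.inl fun x hx => ⟨hl.mem x hx, h x hx⟩
    · push Not at h
      obtain ⟨x, hx, hx4⟩ := h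
      refine Or.inr fun y hy => ⟨hA.neg_mem _ y (hl.mem y hy), ?_⟩
      have h1 := (dist_le_pi_dist x y i₀).trans (hl.dist_le x hx y hy)
      have h2 := hmr.trans_le (min_le_right _ _)
      have h3 := le_abs_self (x i₀ - y i₀)
      rw [← Real.dist_eq] at h3
      rw [Pi.neg_apply]
      linarith

end AntipodalFree

/-- For every `l ≥ 2` there is no continuous map `g : S^{2l-2} → ‖K‖` to the
geometric realization of a finite simplicial complex `K` of dimension at most
`l - 1` satisfying `g x ≠ g (-x)` for all `x` in the sphere.  (Here `S^{2l-2}` is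
the unit sphere in `ℝ^{2l-1}`, and `dim K ≤ l - 1` means every face of `K` has at
most `l` vertices.) -/
theorem no_antipodal_free_map (l : ℕ) (hl : 2 ≤ l) :
    ¬ ∃ (N : ℕ) (K : Geometry.SimplicialComplex ℝ (EuclideanSpace ℝ (Fin N)))
        (g : EuclideanSpace ℝ (Fin (2 * l - 1)) → EuclideanSpace ℝ (Fin N)),
      K.faces.Finite ∧ (∀ s ∈ K.faces, s.card ≤ l) ∧
      ContinuousOn g (Metric.sphere 0 1) ∧
      (∀ x ∈ Metric.sphere (0 : EuclideanSpace ℝ (Fin (2 * l - 1))) 1,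
        g x ∈ K.space) ∧
      (∀ x ∈ Metric.sphere (0 : EuclideanSpace ℝ (Fin (2 * l - 1))) 1,
        g x ≠ g (-x)) := by
  classical
  rintro ⟨M, K, g, hfin, hcard, hg, hgK, hgne⟩
  obtain ⟨k, rfl⟩ : ∃ k, l = k + 1 := ⟨l - 1, by omega⟩
  let Φ : EuclideanSpace ℝ (Fin M) ≃L[ℝ] (Fin M → ℝ) := EuclideanSpace.equiv (Fin M) ℝ
  let Ψ : (Fin (2 * (k + 1) - 1) → ℝ) ≃L[ℝ] EuclideanSpace ℝ (Fin (2 * (k + 1) - 1)) :=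
    (EuclideanSpace.equiv _ ℝ).symm
  let dir : (Fin (2 * (k + 1) - 1) → ℝ) → EuclideanSpace ℝ (Fin (2 * (k + 1) - 1)) :=
    fun x => ‖Ψ x‖⁻¹ • Ψ x
  have hΨ : ∀ x ≠ 0, Ψ x ≠ 0 := fun x hx => by simpa using hx
  have hdir : ∀ x ≠ 0, dir x ∈ Metric.sphere 0 1 := fun x hx => by
    rw [mem_sphere_zero_iff_norm]
    exact norm_smul_inv_norm (𝕜 := ℝ) (hΨ x hx)
  have hdirneg : ∀ x, dir (-x) = -dir x := fun x => by simp [dir]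
  have hspace : K.space = ⋃ s ∈ K.faces, convexHull ℝ (s : Set (EuclideanSpace ℝ (Fin M))) := rfl
  obtain ⟨x, hx, hxx⟩ := AntipodalFree.exists_antipodal_coincidence (k := k) (by omega)
    (show 2 * (k + 1) - 1 = 2 * k + 1 by omega)
    ((fun s : Finset (EuclideanSpace ℝ (Fin M)) => affineSpan ℝ (s.image Φ : Set (Fin M → ℝ))) ''
      K.faces)
    (hfin.countable.image _)
    (by
      rintro _ ⟨s, hs, rfl⟩ -
      obtain ⟨c, hc⟩ : ∃ c, s.card = c + 1 :=
        ⟨s.card - 1, by have := (K.nonempty_of_mem_faces hs).card_pos; omega⟩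
      have h1 := finrank_vectorSpan_image_finset_le ℝ Φ s hc
      have h2 := hcard s hs
      rw [direction_affineSpan]
      omega)
    (Y := Φ '' K.space)
    (by
      refine IsCompact.image ?_ Φ.continuous
      rw [hspace]
      exact hfin.isCompact_biUnion fun s _ => s.finite_toSet.isCompact_convexHull ℝ)
    (by
      rintro _ ⟨y, hy, rfl⟩
      rw [hspace] at hy
      simp only [Set.mem_iUnion] at hy
      obtain ⟨s, hs, hys⟩ := hy
      refine ⟨_, ⟨s, hs, rfl⟩, convexHull_subset_affineSpan _ ?_⟩
      rw [Finset.coe_image]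
      have h := Φ.toLinearEquiv.toLinearMap.image_convexHull (s : Set (EuclideanSpace ℝ (Fin M)))
      exact h.subset (Set.mem_image_of_mem _ hys))
    (fun x => Φ (g (dir x)))
    (by
      refine Φ.continuous.comp_continuousOn (hg.comp ?_ hdir)
      exact (Ψ.continuous.norm.continuousOn.inv₀ fun x hx => norm_ne_zero_iff.2 (hΨ x hx)).smul
        Ψ.continuous.continuousOn)
    (fun x hx => ⟨_, hgK _ (hdir x hx), rfl⟩)
    (by
      intro x hx c hc
      have : dir (c • x) = dir x := by
        simp only [dir, map_smul, norm_smul, Real.norm_eq_abs, abs_of_pos hc, smul_smul, mul_inv]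
        congr 1
        field_simp
      simp only [this])
  refine hgne _ (hdir x hx) (Φ.injective ?_)
  rw [← hdirneg]
  exact hxx
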